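/- arXiv:2511.06482 — 2 statements merged into one kernel-verified Lean document; each statement's English description precedes it below -/
import Mathlib

section
/- Let e ≥ 5 and 2 ≤ n ≤ e−2 be integers. Then the numerical semigroup S(e,1,n) is not symmetric: there exists a natural number k with k ∉ S(e,1,n) and F − k ∉ S(e,1,n), where F is the Frobenius number of S(e,1,n). (Explicitly: for n = 2 one may take k = 1 with F = 2e+2; for n = 3 one may take k = 2 with F = 2e+3; for n ≥ 4 one may take k = e+n with F = 2e+1.) -/
/-- The numerical semigroup `S(e,m,n)`, i.e. the additive submonoid of `ℕ` generated by
`{e, e+1, …, 2e−1} \ {e+m, e+n}`. -/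
def sallySemigroup (e m n : ℕ) : AddSubmonoid ℕ :=
  AddSubmonoid.closure {k : ℕ | e ≤ k ∧ k ≤ 2 * e - 1 ∧ k ≠ e + m ∧ k ≠ e + n}

theorem mem_sallySemigroup_of_mem_generators {e m n k : ℕ}
    (h : e ≤ k ∧ k ≤ 2 * e - 1 ∧ k ≠ e + m ∧ k ≠ e + n) : k ∈ sallySemigroup e m n :=
  AddSubmonoid.subset_closure h

/-- A nonzero element of `S(e,m,n)` below `3e` is a generator or a sum of two generators. -/
theorem sallySemigroup_cases {e m n k : ℕ} (h : k ∈ sallySemigroup e m n) :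
    k = 0 ∨ (e ≤ k ∧ k ≤ 2 * e - 1 ∧ k ≠ e + m ∧ k ≠ e + n) ∨
      (∃ a b : ℕ, (e ≤ a ∧ a ≤ 2 * e - 1 ∧ a ≠ e + m ∧ a ≠ e + n) ∧
        (e ≤ b ∧ b ≤ 2 * e - 1 ∧ b ≠ e + m ∧ b ≠ e + n) ∧ k = a + b) ∨ 3 * e ≤ k := by
  induction h using AddSubmonoid.closure_induction with
  | mem x hx => exact Or.inr (Or.inl hx)
  | zero => exact Or.inl rfl
  | add x y _ _ hx hy =>
    rcases hx with rfl | hx | ⟨a, b, ha, hb, rfl⟩ | hx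
    · simpa using hy
    · rcases hy with rfl | hy | ⟨c, d, hc, hd, rfl⟩ | hy
      · exact Or.inr (Or.inl hx)
      · exact Or.inr (Or.inr (Or.inl ⟨x, y, hx, hy, rfl⟩))
      · exact Or.inr (Or.inr (Or.inr (by omega)))
      · exact Or.inr (Or.inr (Or.inr (by omega)))
    · rcases hy with rfl | hy | ⟨c, d, hc, hd, rfl⟩ | hy
      · exact Or.inr (Or.inr (Or.inl ⟨a, b, ha, hb, rfl⟩))
      all_goals exact Or.inr (Or.inr (Or.inr (by omega)))
    · exact Or.inr (Or.inr (Or.inr (by omega)))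

/-- An additive submonoid of `ℕ` containing `e > 0` and the `e` integers following `F` contains
every integer larger than `F`. -/
theorem AddSubmonoid.mem_of_lt_of_forall_mem_window {S : AddSubmonoid ℕ} {e F : ℕ} (he : 0 < e)
    (heS : e ∈ S) (h : ∀ k, F < k → k ≤ F + e → k ∈ S) (k : ℕ) (hk : F < k) : k ∈ S := by
  induction k using Nat.strong_induction_on with
  | _ k ih =>
    by_cases hke : k ≤ F + e
    · exact h k hk hke
    · have hsub := S.add_mem (ih (k - e) (by omega) (by omega)) heS
      rwa [Nat.sub_add_cancel (by omega)] at hsub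

theorem add_mem_sallySemigroup {e m n k : ℕ} (a b : ℕ)
    (ha : e ≤ a ∧ a ≤ 2 * e - 1 ∧ a ≠ e + m ∧ a ≠ e + n)
    (hb : e ≤ b ∧ b ≤ 2 * e - 1 ∧ b ≠ e + m ∧ b ≠ e + n) (hk : k = a + b) :
    k ∈ sallySemigroup e m n :=
  hk ▸ add_mem (mem_sallySemigroup_of_mem_generators ha) (mem_sallySemigroup_of_mem_generators hb)

theorem stmt11 (e n : ℕ) (he : 5 ≤ e) (hn2 : 2 ≤ n) (hne : n ≤ e - 2) :
    ∃ F : ℕ, (F ∉ sallySemigroup e 1 n ∧ ∀ k : ℕ, F < k → k ∈ sallySemigroup e 1 n) ∧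
      ∃ k : ℕ, k ∉ sallySemigroup e 1 n ∧ F - k ∉ sallySemigroup e 1 n := by
  have heS : e ∈ sallySemigroup e 1 n := mem_sallySemigroup_of_mem_generators (by omega)
  have h3e : 3 * e ∈ sallySemigroup e 1 n := by
    simpa using AddSubmonoid.nsmul_mem _ heS 3
  have gap : ∀ k, k ≠ 0 → (k < e ∨ k = e + n ∨ k = 2 * e + 1 ∨ (n ≤ 3 ∧ k = 2 * e + n)) →
      k ∉ sallySemigroup e 1 n := by
    intro k hk0 hk hmem
    rcases sallySemigroup_cases hmem with h | h | ⟨a, b, ha, hb, h⟩ | h <;> omega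
  obtain rfl | rfl | hn4 : n = 2 ∨ n = 3 ∨ 4 ≤ n := by omega
  · refine ⟨2 * e + 2, ⟨gap _ (by omega) (by omega), AddSubmonoid.mem_of_lt_of_forall_mem_window
      (by omega) heS fun k hk hk' => ?_⟩, 1, gap _ (by omega) (by omega),
      gap _ (by omega) (by omega)⟩
    obtain h | rfl | h : k < 3 * e ∨ k = 3 * e ∨ 3 * e < k := by omega
    · exact add_mem_sallySemigroup e (k - e) (by omega) (by omega) (by omega)
    · exact h3e
    · exact add_mem_sallySemigroup (e + 3) (k - (e + 3)) (by omega) (by omega) (by omega)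
  · refine ⟨2 * e + 3, ⟨gap _ (by omega) (by omega), AddSubmonoid.mem_of_lt_of_forall_mem_window
      (by omega) heS fun k hk hk' => ?_⟩, 2, gap _ (by omega) (by omega),
      gap _ (by omega) (by omega)⟩
    obtain h | rfl | rfl | rfl | rfl : k < 3 * e ∨ k = 3 * e ∨ k = 3 * e + 1 ∨ k = 3 * e + 2 ∨
      k = 3 * e + 3 := by omega
    · exact add_mem_sallySemigroup e (k - e) (by omega) (by omega) (by omega)
    · exact h3e
    · exact add_mem_sallySemigroup (e + 2) (2 * e - 1) (by omega) (by omega) (by omega)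
    · have h2 : e + 2 ∈ sallySemigroup e 1 3 := mem_sallySemigroup_of_mem_generators (by omega)
      have hsum := add_mem (add_mem heS heS) h2
      rwa [show e + e + (e + 2) = 3 * e + 2 by ring] at hsum
    · exact add_mem_sallySemigroup (e + 4) (2 * e - 1) (by omega) (by omega) (by omega)
  · refine ⟨2 * e + 1, ⟨gap _ (by omega) (by omega), AddSubmonoid.mem_of_lt_of_forall_mem_window
      (by omega) heS fun k hk hk' => ?_⟩, e + n, gap _ (by omega) (by omega),
      gap _ (by omega) (by omega)⟩
    obtain rfl | rfl | rfl | ⟨h, h'⟩ : k = 3 * e ∨ k = 3 * e + 1 ∨ k = 2 * e + n ∨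
      (k < 3 * e ∧ k ≠ 2 * e + n) := by omega
    · exact h3e
    · exact add_mem_sallySemigroup (e + 2) (2 * e - 1) (by omega) (by omega) (by omega)
    · exact add_mem_sallySemigroup (e + 2) (e + n - 2) (by omega) (by omega) (by omega)
    · exact add_mem_sallySemigroup e (k - e) (by omega) (by omega) (by omega)
end

section
/- Let e ≥ 4 and 1 ≤ m < n ≤ e−2 be integers. The ring K[\bar S(e,m,n)] is Cohen–Macaulay if and only if (m,n) ≠ (e−4, e−3); formally, the sequence (y, x_{e−1}) of homogeneous linear elements is a regular sequence on K[\bar S(e,m,n)] if and only if (m,n) ≠ (e−4, e−3). -/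
open MvPolynomial

/-- Index set of the polynomial ring `R(e,m,n)`: indices `i ∈ {0,…,e−1} \ {m,n}`. -/
abbrev SallyIdx (e m n : ℕ) : Type := {i : ℕ // i < e ∧ i ≠ m ∧ i ≠ n}

/-- The variable `x_i` of `R(e,m,n)[y]` (and `0` for an invalid index); the extra
variable `y` is `X none`. -/
noncomputable def bX (e m n : ℕ) (i : ℕ) : MvPolynomial (Option (SallyIdx e m n)) ℚ :=
  if h : i < e ∧ i ≠ m ∧ i ≠ n then MvPolynomial.X (some ⟨i, h⟩) else 0

/-- The `ℚ`-algebra homomorphism `R(e,m,n)[y] → ℚ[t₁,t₂]` sending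
`x_i ↦ t₁^{e+i} t₂^{e−1−i}` and `y ↦ t₂^{2e−1}`. -/
noncomputable def barMap (e m n : ℕ) :
    MvPolynomial (Option (SallyIdx e m n)) ℚ →ₐ[ℚ] MvPolynomial (Fin 2) ℚ :=
  MvPolynomial.aeval (fun i : Option (SallyIdx e m n) =>
    match i with
    | none => (MvPolynomial.X 1 : MvPolynomial (Fin 2) ℚ) ^ (2 * e - 1)
    | some j => (MvPolynomial.X 0 : MvPolynomial (Fin 2) ℚ) ^ (e + j.1) *
        (MvPolynomial.X 1 : MvPolynomial (Fin 2) ℚ) ^ (e - 1 - j.1))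

/-- The defining ideal `I_{\bar S(e,m,n)}` of the projective monomial curve. -/
noncomputable def barIdeal (e m n : ℕ) : Ideal (MvPolynomial (Option (SallyIdx e m n)) ℚ) :=
  RingHom.ker (barMap e m n).toRingHom

/-- `OffsetSum e m n k u` says that `u` is a sum of exactly `k` elements of
`{0,…,e−1} \ {m,n}`. -/
def OffsetSum (e m n : ℕ) : ℕ → ℕ → Prop
  | 0, u => u = 0
  | k + 1, u => ∃ i v, (i < e ∧ i ≠ m ∧ i ≠ n) ∧ OffsetSum e m n k v ∧ u = v + i

namespace OffsetSum

variable {e m n : ℕ}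

lemma succ {k v i : ℕ} (hi : i < e ∧ i ≠ m ∧ i ≠ n) (h : OffsetSum e m n k v) :
    OffsetSum e m n (k + 1) (v + i) :=
  ⟨i, v, hi, h, rfl⟩

lemma succ_zero {k v : ℕ} (hi : 0 < e ∧ 0 ≠ m ∧ 0 ≠ n) (h : OffsetSum e m n k v) :
    OffsetSum e m n (k + 1) v :=
  succ hi h

lemma succ_of_le {k v i : ℕ} (hi : i < e ∧ i ≠ m ∧ i ≠ n) (hiv : i ≤ v)
    (h : OffsetSum e m n k (v - i)) : OffsetSum e m n (k + 1) v :=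
  ⟨i, v - i, hi, h, by omega⟩

lemma two {i j v : ℕ} (hi : i < e ∧ i ≠ m ∧ i ≠ n) (hj : j < e ∧ j ≠ m ∧ j ≠ n)
    (hv : v = i + j) : OffsetSum e m n 2 v :=
  ⟨j, i, hj, ⟨i, 0, hi, rfl, by omega⟩, hv⟩

lemma three {i j l v : ℕ} (hi : i < e ∧ i ≠ m ∧ i ≠ n) (hj : j < e ∧ j ≠ m ∧ j ≠ n)
    (hl : l < e ∧ l ≠ m ∧ l ≠ n) (hv : v = i + j + l) : OffsetSum e m n 3 v :=
  ⟨l, i + j, hl, two hi hj rfl, hv⟩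

lemma le {k u : ℕ} (h : OffsetSum e m n k u) : u ≤ k * (e - 1) := by
  induction k generalizing u with
  | zero => exact Nat.le_of_eq (by simpa [OffsetSum] using h)
  | succ k ih =>
    obtain ⟨i, v, hi, hv, rfl⟩ := h
    have := ih hv
    rw [Nat.succ_mul]
    omega

/-- Either the largest offset occurs in the sum, or the sum is bounded in terms of the second
largest one. -/
lemma remove_last_or_le {t : ℕ} (ht : ∀ i, i < e ∧ i ≠ m ∧ i ≠ n → i ≠ e - 1 → i ≤ t)
    {k u : ℕ} (h : OffsetSum e m n k u) :
    (∃ j v, k = j + 1 ∧ u = v + (e - 1) ∧ OffsetSum e m n j v) ∨ u ≤ k * t := by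
  induction k generalizing u with
  | zero => exact Or.inr (Nat.le_of_eq (by simpa [OffsetSum] using h))
  | succ k ih =>
    obtain ⟨i, v, hi, hv, rfl⟩ := h
    by_cases hie : i = e - 1
    · exact Or.inl ⟨k, v, rfl, by rw [hie], hv⟩
    · rcases ih hv with ⟨j, w, rfl, rfl, hw⟩ | hle
      · exact Or.inl ⟨j + 1, w + i, rfl, by omega, succ hi hw⟩
      · have := ht i hi hie
        right
        rw [Nat.succ_mul]
        omega

lemma of_two (hm : 1 ≤ m) (hmn : m < n) (hn : n + 2 ≤ e) {u : ℕ} (h₁ : e ≤ u)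
    (h₂ : u + 6 ≤ 2 * e ∨ u + 5 = 2 * e ∧ m + 4 ≠ e) : OffsetSum e m n 2 u := by
  by_contra hc
  have key : ∀ i j, u = i + j → ¬ ((i < e ∧ i ≠ m ∧ i ≠ n) ∧ (j < e ∧ j ≠ m ∧ j ≠ n)) :=
    fun i j hu hij => hc (two hij.1 hij.2 hu)
  have k1 := key (e - 1) (u - (e - 1)) (by omega)
  have k2 := key (e - 2) (u - (e - 2)) (by omega)
  have k3 := key (e - 3) (u - (e - 3)) (by omega)
  clear key hc
  omega

lemma of_three (he : 6 ≤ e) (hm : 1 ≤ m) (hmn : m < n) (hn : n + 2 ≤ e) {u : ℕ} (h₁ : e ≤ u)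
    (h₂ : u + 7 ≤ 3 * e) : OffsetSum e m n 3 u := by
  by_cases hu : u + 6 ≤ 2 * e
  · exact succ_zero (by omega) (of_two hm hmn hn h₁ (Or.inl hu))
  by_cases hu' : 2 * e ≤ u + 1
  · exact succ_of_le (i := e - 1) (by omega) (by omega)
      (of_two hm hmn hn (by omega) (Or.inl (by omega)))
  by_contra hc
  have key : ∀ i j l, u = i + j + l → ¬ ((i < e ∧ i ≠ m ∧ i ≠ n) ∧ (j < e ∧ j ≠ m ∧ j ≠ n) ∧
      (l < e ∧ l ≠ m ∧ l ≠ n)) :=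
    fun i j l hu h => hc (three h.1 h.2.1 h.2.2 hu)
  have k1 := key (e - 1) (u - (e - 1)) 0 (by omega)
  have k2 := key (e - 1) (u - (e - 1) - 1) 1 (by omega)
  have k3 := key (e - 1) (u - (e - 1) - 2) 2 (by omega)
  have k4 := key (e - 2) (u - (e - 2)) 0 (by omega)
  clear key hc
  omega

lemma of_three_le (he : 6 ≤ e) (hm : 1 ≤ m) (hmn : m < n) (hn : n + 2 ≤ e) {k u : ℕ}
    (hk : 3 ≤ k) (h₁ : e ≤ u) (h₂ : u + 4 ≤ k * (e - 1)) : OffsetSum e m n k u := by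
  induction k, hk using Nat.le_induction generalizing u with
  | base => exact of_three he hm hmn hn h₁ (by omega)
  | succ k hk ih =>
    rw [Nat.succ_mul] at h₂
    by_cases hu : u + 4 ≤ k * (e - 1)
    · exact succ_zero (by omega) (ih h₁ hu)
    · have : 3 * (e - 1) ≤ k * (e - 1) := Nat.mul_le_mul_right _ hk
      exact succ_of_le (i := e - 1) (by omega) (by omega) (ih (by omega) (by omega))

lemma even {k u : ℕ} (h : OffsetSum 5 1 3 k u) : Even u := by
  induction k generalizing u with
  | zero => simp [show u = 0 from h]
  | succ k ih =>
    obtain ⟨i, v, hi, hv, rfl⟩ := h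
    exact (ih hv).add (by rw [Nat.even_iff]; omega)

lemma of_even {k u : ℕ} (h : u ≤ 4 * k) (hu : Even u) : OffsetSum 5 1 3 k u := by
  rw [Nat.even_iff] at hu
  induction k generalizing u with
  | zero => exact Nat.le_zero.mp h
  | succ k ih =>
    by_cases h₀ : u ≤ 4 * k
    · exact succ_zero (by omega) (ih h₀ hu)
    by_cases h₂ : u = 2
    · exact succ_of_le (i := 2) (by omega) (by omega) (ih (by omega) (by omega))
    · exact succ_of_le (i := 4) (by omega) (by omega) (ih (by omega) (by omega))

lemma of_le {k u : ℕ} (h : u ≤ k) : OffsetSum 5 2 3 k u := by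
  induction k generalizing u with
  | zero => exact Nat.le_zero.mp h
  | succ k ih =>
    by_cases h₀ : u ≤ k
    · exact succ_zero (by omega) (ih h₀)
    · exact succ_of_le (i := 1) (by omega) (by omega) (ih (by omega))

/-- If `s` is a sum of `k` generators of `S(e,m,n)` and `s + (2e−1)` is a sum of at most `k`
generators, then `s` is a sum of fewer than `k` generators. -/
lemma exists_lt (he : 4 ≤ e) (hm : 1 ≤ m) (hmn : m < n) (hn : n + 2 ≤ e)
    (hne : ¬ (m + 4 = e ∧ n + 3 = e)) {k u k' u' : ℕ} (h : OffsetSum e m n k u)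
    (h' : OffsetSum e m n k' u') (hk : k' ≤ k)
    (heq : e * k + u + (2 * e - 1) = e * k' + u') :
    ∃ k₁ u₁, OffsetSum e m n k₁ u₁ ∧ k₁ < k ∧ e * k₁ + u₁ = e * k + u := by
  have hpos : k' ≠ 0 := by
    rintro rfl
    have : u' = 0 := h'
    omega
  obtain ⟨K, rfl⟩ := Nat.exists_eq_succ_of_ne_zero hpos
  obtain ⟨t, ht, ht₂, ht₃, ht₄⟩ : ∃ t,
      (∀ i, i < e ∧ i ≠ m ∧ i ≠ n → i ≠ e - 1 → i ≤ t) ∧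
      t + 2 ≤ e ∧ (n + 2 = e → t + 3 ≤ e) ∧ (m + 3 = e → t + 4 = e) := by
    by_cases h₁ : n + 2 = e
    · by_cases h₂ : m + 3 = e
      · exact ⟨e - 4, fun i hi hi' => by omega, by omega⟩
      · exact ⟨e - 3, fun i hi hi' => by omega, by omega⟩
    · exact ⟨e - 2, fun i hi hi' => by omega, by omega⟩
  rcases remove_last_or_le ht h' with ⟨j, v, hj, rfl, hv⟩ | hle
  · obtain rfl : K = j := by omega
    refine ⟨K, v, hv, by omega, ?_⟩
    rw [Nat.mul_succ] at heq
    omega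
  have hek : e * (K + 1) ≤ e * k := Nat.mul_le_mul_left _ hk
  simp only [Nat.succ_eq_add_one] at *
  rw [Nat.mul_succ] at heq hek
  rw [Nat.succ_mul] at hle
  suffices hs : OffsetSum e m n K (u' - (e - 1)) from
    ⟨K, u' - (e - 1), hs, by omega, by omega⟩
  have hU : e + (e - 1) ≤ u' := by omega
  have hKt : K * t + K ≤ K * (e - 1) := by
    rw [← Nat.mul_succ]
    exact Nat.mul_le_mul_left _ (by omega)
  rcases Nat.lt_or_ge e 6 with h6 | h6
  · have hcases : (e = 4 ∧ m = 1 ∧ n = 2) ∨ (e = 5 ∧ m = 1 ∧ n = 3) ∨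
        (e = 5 ∧ m = 2 ∧ n = 3) := by omega
    rcases hcases with ⟨rfl, rfl, rfl⟩ | ⟨rfl, rfl, rfl⟩ | ⟨rfl, rfl, rfl⟩
    · obtain rfl : t = 0 := by omega
      omega
    · refine of_even (by omega) ?_
      have := h'.even
      rw [Nat.even_iff] at this ⊢
      omega
    · obtain rfl : t = 1 := by omega
      exact of_le (by omega)
  · rcases Nat.lt_or_ge K 3 with h3 | h3
    · interval_cases K
      · omega
      · omega
      · exact of_two hm hmn hn (by omega) (by omega)
    · exact of_three_le h6 hm hmn hn h3 (by omega) (by omega)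

end OffsetSum

/-- The affine semigroup `\bar S(e,m,n)`, in terms of the number `k` of generators
`(e+i, e−1−i)`, the sum `u` of their offsets `i`, and the multiplicity `r` of `(0, 2e−1)`. -/
def BarMem (e m n : ℕ) (a : Fin 2 →₀ ℕ) : Prop :=
  ∃ k u r, OffsetSum e m n k u ∧ a 0 = e * k + u ∧ a 1 + u = (e - 1) * k + r * (2 * e - 1)

lemma bX_eq {e m n i : ℕ} (h : i < e ∧ i ≠ m ∧ i ≠ n) : bX e m n i = X (some ⟨i, h⟩) :=
  dif_pos h

lemma barMap_X_none (e m n : ℕ) :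
    barMap e m n (X none) = monomial (Finsupp.single 1 (2 * e - 1)) 1 := by
  simp [barMap, X_pow_eq_monomial]

lemma barMap_X_some (e m n : ℕ) (j : SallyIdx e m n) :
    barMap e m n (X (some j)) =
      monomial (Finsupp.single 0 (e + j.1) + Finsupp.single 1 (e - 1 - j.1)) 1 := by
  simp [barMap, X_pow_eq_monomial, monomial_mul]

lemma barMap_bX {e m n i : ℕ} (h : i < e ∧ i ≠ m ∧ i ≠ n) : barMap e m n (bX e m n i) =
      monomial (Finsupp.single 0 (e + i) + Finsupp.single 1 (e - 1 - i)) 1 := by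
  rw [bX_eq h, barMap_X_some]

lemma monomial_congr {a b : Fin 2 →₀ ℕ} (h₀ : a 0 = b 0) (h₁ : a 1 = b 1) :
    monomial a (1 : ℚ) = monomial b 1 := by
  rw [show a = b from Finsupp.ext fun i => by fin_cases i <;> assumption]

lemma exists_add_of_mem_support_mul_monomial {σ : Type*} {p : MvPolynomial σ ℚ} {a b : σ →₀ ℕ}
    (h : a ∈ (p * monomial b 1).support) : ∃ c ∈ p.support, a = c + b := by
  classical
  rw [mem_support_iff, coeff_mul_monomial'] at h
  split_ifs at h with hb
  · exact ⟨a - b, by simpa using h, (tsub_add_cancel_of_le hb).symm⟩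
  · exact absurd rfl h

lemma BarMem.of_mem_support {e m n : ℕ} {f : MvPolynomial (Option (SallyIdx e m n)) ℚ}
    {a : Fin 2 →₀ ℕ} (ha : a ∈ (barMap e m n f).support) : BarMem e m n a := by
  classical
  induction f using MvPolynomial.induction_on generalizing a with
  | C r =>
    rw [← algebraMap_eq, AlgHom.commutes, algebraMap_eq] at ha
    have : a = 0 := by
      rw [mem_support_iff, coeff_C] at ha
      by_contra h
      exact ha (if_neg (Ne.symm h))
    subst this
    exact ⟨0, 0, 0, rfl, by simp, by simp⟩
  | add p q hp hq =>
    rw [map_add] at ha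
    rcases Finset.mem_union.mp (support_add ha) with h | h
    exacts [hp h, hq h]
  | mul_X p i hp =>
    rw [map_mul] at ha
    cases i with
    | none =>
      rw [barMap_X_none] at ha
      obtain ⟨c, hc, rfl⟩ := exists_add_of_mem_support_mul_monomial ha
      obtain ⟨k, u, r, hs, h₀, h₁⟩ := hp hc
      refine ⟨k, u, r + 1, hs, by simpa using h₀, ?_⟩
      rw [Nat.succ_mul r]
      simp only [Finsupp.add_apply, Finsupp.single_eq_same]
      omega
    | some j =>
      rw [barMap_X_some] at ha
      obtain ⟨c, hc, rfl⟩ := exists_add_of_mem_support_mul_monomial ha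
      obtain ⟨k, u, r, hs, h₀, h₁⟩ := hp hc
      have := j.2.1
      refine ⟨k + 1, u + j.1, r, hs.succ j.2, ?_, ?_⟩ <;> rw [Nat.mul_succ] <;>
        simp <;> omega

lemma BarMem.exists_barMap_eq {e m n : ℕ} {a : Fin 2 →₀ ℕ} (ha : BarMem e m n a) :
    ∃ f, barMap e m n f = monomial a 1 := by
  obtain ⟨k, u, r, hs, h₀, h₁⟩ := ha
  induction k generalizing a u with
  | zero =>
    obtain rfl : u = 0 := hs
    refine ⟨X none ^ r, ?_⟩
    rw [map_pow, barMap_X_none, monomial_pow, one_pow]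
    apply monomial_congr <;> simp_all
  | succ k ih =>
    obtain ⟨i, v, hi, hv, rfl⟩ := hs
    have hle := hv.le
    rw [Nat.mul_comm] at hle
    rw [Nat.mul_succ] at h₀ h₁
    obtain ⟨f, hf⟩ := ih (a := Finsupp.single 0 (e * k + v) +
      Finsupp.single 1 ((e - 1) * k + r * (2 * e - 1) - v)) v hv (by simp) (by simp; omega)
    refine ⟨f * X (some ⟨i, hi⟩), ?_⟩
    rw [map_mul, hf, barMap_X_some, monomial_mul, one_mul]
    apply monomial_congr <;> simp <;> omega

/-- The exchange property of the affine semigroup equivalent to Cohen–Macaulayness. -/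
lemma BarMem.exchange {e m n : ℕ} (he : 4 ≤ e) (hm : 1 ≤ m) (hmn : m < n) (hn : n + 2 ≤ e)
    (hne : ¬ (m + 4 = e ∧ n + 3 = e)) {a b : Fin 2 →₀ ℕ} (ha : BarMem e m n a)
    (hb : BarMem e m n b)
    (hab : a + Finsupp.single 0 (2 * e - 1) = b + Finsupp.single 1 (2 * e - 1)) :
    ∃ c, BarMem e m n c ∧ a = c + Finsupp.single 1 (2 * e - 1) := by
  have hab₀ := DFunLike.congr_fun hab 0
  have hab₁ := DFunLike.congr_fun hab 1
  simp at hab₀ hab₁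
  suffices h : BarMem e m n (Finsupp.single 0 (a 0) + Finsupp.single 1 (b 1)) by
    refine ⟨_, h, ?_⟩
    ext j
    fin_cases j <;> simp [hab₁]
  obtain ⟨k, u, r, hs, h₀, h₁⟩ := ha
  obtain ⟨k', u', r', hs', h₀', h₁'⟩ := hb
  have hsplit : ∀ x, e * x + (e - 1) * x = x * (2 * e - 1) := fun x => by
    rw [← Nat.add_mul, Nat.mul_comm]
    congr 1
    omega
  have hd : 0 < 2 * e - 1 := by omega
  have hkr : k + r = k' + r' := by
    apply Nat.eq_of_mul_eq_mul_right hd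
    rw [Nat.add_mul, Nat.add_mul, ← hsplit k, ← hsplit k']
    omega
  rcases Nat.eq_zero_or_pos r with rfl | hr
  · obtain ⟨k₁, u₁, hs₁, hlt, heq⟩ := OffsetSum.exists_lt he hm hmn hn hne hs hs'
      (by omega) (by omega)
    obtain ⟨q, rfl⟩ := Nat.exists_eq_add_of_lt hlt
    refine ⟨k₁, u₁, q, hs₁, by simp; omega, ?_⟩
    have := hsplit (k₁ + q + 1)
    have h₂ := hsplit k₁
    simp only [Nat.add_mul _ _ (2 * e - 1), Nat.one_mul] at this
    simp
    omega
  · obtain ⟨r, rfl⟩ := Nat.exists_eq_succ_of_ne_zero hr.ne'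
    refine ⟨k, u, r, hs, by simpa using h₀, ?_⟩
    rw [Nat.succ_mul r] at h₁
    simp
    omega

lemma mk_eq_zero_iff_barMap {e m n : ℕ} (f : MvPolynomial (Option (SallyIdx e m n)) ℚ) :
    Ideal.Quotient.mk (barIdeal e m n) f = 0 ↔ barMap e m n f = 0 := by
  rw [Ideal.Quotient.eq_zero_iff_mem]
  exact RingHom.mem_ker

lemma mk_mk_eq_zero_iff {e m n : ℕ} (f : MvPolynomial (Option (SallyIdx e m n)) ℚ) :
    Ideal.Quotient.mk (Ideal.span {Ideal.Quotient.mk (barIdeal e m n) (X none)})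
        (Ideal.Quotient.mk (barIdeal e m n) f) = 0 ↔
      ∃ g, barMap e m n f = barMap e m n g * monomial (Finsupp.single 1 (2 * e - 1)) 1 := by
  rw [Ideal.Quotient.eq_zero_iff_mem, Ideal.mem_span_singleton']
  constructor
  · rintro ⟨z, hz⟩
    obtain ⟨g, rfl⟩ := Ideal.Quotient.mk_surjective z
    refine ⟨g, ?_⟩
    rw [← map_mul, ← sub_eq_zero, ← map_sub, mk_eq_zero_iff_barMap, map_sub, sub_eq_zero,
      map_mul, barMap_X_none] at hz
    exact hz.symm
  · rintro ⟨g, hg⟩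
    refine ⟨Ideal.Quotient.mk _ g, ?_⟩
    rw [← map_mul, ← sub_eq_zero, ← map_sub, mk_eq_zero_iff_barMap, map_sub, sub_eq_zero,
      map_mul, barMap_X_none, hg]

lemma mk_mem_nonZeroDivisors_iff {R : Type*} [CommRing R] (I : Ideal R) (x : R) :
    Ideal.Quotient.mk I x ∈ nonZeroDivisors (R ⧸ I) ↔
      ∀ f, Ideal.Quotient.mk I (f * x) = 0 → Ideal.Quotient.mk I f = 0 := by
  refine Iff.trans mem_nonZeroDivisors_iff_right ⟨fun h f hf => h _ (by rwa [← map_mul]), ?_⟩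
  intro h z hz
  obtain ⟨f, rfl⟩ := Ideal.Quotient.mk_surjective z
  exact h f (by rwa [map_mul])

lemma mk_X_none_mem_nonZeroDivisors (e m n : ℕ) :
    Ideal.Quotient.mk (barIdeal e m n) (X none) ∈
      nonZeroDivisors (MvPolynomial (Option (SallyIdx e m n)) ℚ ⧸ barIdeal e m n) := by
  refine (mk_mem_nonZeroDivisors_iff _ _).mpr fun f hz => ?_
  rw [mk_eq_zero_iff_barMap, map_mul, barMap_X_none] at hz
  rw [mk_eq_zero_iff_barMap]
  exact (mul_eq_zero.mp hz).resolve_right (by simp)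

lemma mk_mk_bX_last_mem_nonZeroDivisors {e m n : ℕ} (he : 4 ≤ e) (hm : 1 ≤ m) (hmn : m < n)
    (hn : n + 2 ≤ e) (hne : ¬ (m + 4 = e ∧ n + 3 = e)) :
    Ideal.Quotient.mk (Ideal.span {Ideal.Quotient.mk (barIdeal e m n) (X none)})
        (Ideal.Quotient.mk (barIdeal e m n) (bX e m n (e - 1))) ∈
      nonZeroDivisors ((MvPolynomial (Option (SallyIdx e m n)) ℚ ⧸ barIdeal e m n) ⧸
        Ideal.span {Ideal.Quotient.mk (barIdeal e m n) (X none)}) := by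
  refine (mk_mem_nonZeroDivisors_iff _ _).mpr fun z hz => ?_
  obtain ⟨f, rfl⟩ := Ideal.Quotient.mk_surjective z
  rw [← map_mul, mk_mk_eq_zero_iff] at hz
  obtain ⟨g, hg⟩ := hz
  have hlast : Finsupp.single (0 : Fin 2) (e + (e - 1)) + Finsupp.single 1 (e - 1 - (e - 1)) =
      Finsupp.single 0 (2 * e - 1) := by
    rw [Nat.sub_self, Finsupp.single_zero, add_zero]
    congr 1
    omega
  rw [map_mul, barMap_bX (by omega), hlast] at hg
  rw [mk_mk_eq_zero_iff]
  suffices h : barMap e m n f ∈ LinearMap.range ((LinearMap.mulRight ℚ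
      (monomial (Finsupp.single (1 : Fin 2) (2 * e - 1)) (1 : ℚ))) ∘ₗ
        (barMap e m n).toLinearMap) by
    obtain ⟨p, hp⟩ := h
    exact ⟨p, hp.symm⟩
  rw [(barMap e m n f).as_sum]
  refine Submodule.sum_mem _ fun a ha => ?_
  have ha' : a + Finsupp.single 0 (2 * e - 1) ∈
      (barMap e m n g * monomial (Finsupp.single 1 (2 * e - 1)) 1).support := by
    rw [← hg, mem_support_iff, coeff_mul_monomial, mul_one]
    exact mem_support_iff.mp ha
  obtain ⟨b, hb, hab⟩ := exists_add_of_mem_support_mul_monomial ha'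
  obtain ⟨c, hc, hac⟩ := (BarMem.of_mem_support ha).exchange he hm hmn hn hne
    (BarMem.of_mem_support hb) hab
  obtain ⟨p, hp⟩ := hc.exists_barMap_eq
  refine ⟨coeff a (barMap e m n f) • p, ?_⟩
  simp only [LinearMap.comp_apply, AlgHom.toLinearMap_apply, map_smul, hp,
    LinearMap.mulRight_apply, monomial_mul, mul_one, ← hac, smul_monomial, smul_eq_mul]

lemma mk_mk_bX_last_notMem_nonZeroDivisors {e m n : ℕ} (hm : 1 ≤ m) (hme : m + 4 = e)
    (hne : n + 3 = e) :
    Ideal.Quotient.mk (Ideal.span {Ideal.Quotient.mk (barIdeal e m n) (X none)})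
        (Ideal.Quotient.mk (barIdeal e m n) (bX e m n (e - 1))) ∉
      nonZeroDivisors ((MvPolynomial (Option (SallyIdx e m n)) ℚ ⧸ barIdeal e m n) ⧸
        Ideal.span {Ideal.Quotient.mk (barIdeal e m n) (X none)}) := by
  intro h
  have hz := (mk_mem_nonZeroDivisors_iff _ _).mp h (Ideal.Quotient.mk _
    (bX e m n 0 * bX e m n 0 * bX e m n (e - 5))) (by
      rw [← map_mul, mk_mk_eq_zero_iff]
      refine ⟨bX e m n (e - 2) * bX e m n (e - 2) * bX e m n (e - 2), ?_⟩
      simp only [map_mul]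
      rw [barMap_bX (by omega), barMap_bX (by omega), barMap_bX (by omega), barMap_bX (by omega)]
      simp only [monomial_mul, mul_one]
      apply monomial_congr <;> simp <;> omega)
  rw [mk_mk_eq_zero_iff] at hz
  obtain ⟨g, hg⟩ := hz
  simp only [map_mul] at hg
  rw [barMap_bX (by omega), barMap_bX (by omega)] at hg
  simp only [monomial_mul, mul_one] at hg
  have hsupp := congrArg MvPolynomial.support hg
  classical
  rw [support_monomial, if_neg one_ne_zero] at hsupp
  obtain ⟨c, hc, hac⟩ := exists_add_of_mem_support_mul_monomial
    (Finset.ext_iff.mp hsupp _ |>.mp (Finset.mem_singleton_self _))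
  obtain ⟨k, u, r, hs, h₀, h₁⟩ := BarMem.of_mem_support hc
  have hac₀ := DFunLike.congr_fun hac 0
  have hac₁ := DFunLike.congr_fun hac 1
  simp at hac₀ hac₁
  obtain ⟨e, rfl⟩ := Nat.exists_eq_add_of_le' (show 5 ≤ e by omega)
  obtain rfl : m = e + 1 := by omega
  obtain rfl : n = e + 2 := by omega
  rcases Nat.lt_or_ge k 3 with hk | hk
  · interval_cases k
    · obtain rfl : u = 0 := hs
      omega
    · obtain ⟨i, v, hi, hv, rfl⟩ := hs
      obtain rfl : v = 0 := hv
      omega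
    · obtain ⟨i, v, hi, ⟨j, w, hj, hw, rfl⟩, rfl⟩ := hs
      obtain rfl : w = 0 := hw
      omega
  · have : (2 * e + 9) * 3 ≤ (2 * e + 9) * k := Nat.mul_le_mul_left _ hk
    have : (2 * e + 9) * k = (e + 5) * k + (e + 5 - 1) * k := by
      rw [← Nat.add_mul]
      congr 1
      omega
    omega

theorem stmt13 (e m n : ℕ) (he : 4 ≤ e) (hm : 1 ≤ m) (hmn : m < n) (hn : n ≤ e - 2) :
    -- `(y, x_{e−1})` is a regular sequence on `K[\bar S(e,m,n)]` iff `(m,n) ≠ (e−4,e−3)`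
    ((Ideal.Quotient.mk (barIdeal e m n) (MvPolynomial.X none) ∈
        nonZeroDivisors (MvPolynomial (Option (SallyIdx e m n)) ℚ ⧸ barIdeal e m n)) ∧
      Ideal.Quotient.mk
          (Ideal.span {Ideal.Quotient.mk (barIdeal e m n) (MvPolynomial.X none)})
          (Ideal.Quotient.mk (barIdeal e m n) (bX e m n (e-1))) ∈
        nonZeroDivisors
          ((MvPolynomial (Option (SallyIdx e m n)) ℚ ⧸ barIdeal e m n) ⧸
            Ideal.span {Ideal.Quotient.mk (barIdeal e m n) (MvPolynomial.X none)}))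
    ↔ (m, n) ≠ (e - 4, e - 3) := by
  have hiff : (m, n) ≠ (e - 4, e - 3) ↔ ¬ (m + 4 = e ∧ n + 3 = e) := by
    rw [Ne, Prod.mk.injEq]
    omega
  rw [hiff]
  refine ⟨fun h hc => ?_, fun h => ⟨mk_X_none_mem_nonZeroDivisors e m n, ?_⟩⟩
  · exact mk_mk_bX_last_notMem_nonZeroDivisors hm hc.1 hc.2 h.2
  · exact mk_mk_bX_last_mem_nonZeroDivisors he hm hmn (by omega) h
end
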